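/- The fourth iterated derivative of the function z ↦ (4iz³ − z² + 17iz)/(z+i)² at the point z = i equals −21. -/

import Mathlib

open Complex

theorem iteratedDeriv_succ_eq_of_eventually_hasDerivAt {f g : ℂ → ℂ} {x : ℂ} (n : ℕ)
    (h : ∀ᶠ z in nhds x, HasDerivAt f (g z) z) :
    iteratedDeriv (n + 1) f x = iteratedDeriv n g x := by
  rw [iteratedDeriv_succ']
  exact Filter.EventuallyEq.iteratedDeriv_eq n (h.mono fun z hz => hz.deriv)

theorem hasDerivAt_const_div_add_pow (a c z : ℂ) (n : ℕ) (h : z + c ≠ 0) :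
    HasDerivAt (fun z : ℂ => a / (z + c) ^ n) (-(n * a) / (z + c) ^ (n + 1)) z := by
  have hp := ((hasDerivAt_id z).add_const c).pow n
  refine ((hasDerivAt_const z a).div hp (pow_ne_zero n h)).congr_deriv ?_
  cases n with
  | zero => simp
  | succ k =>
    simp only [id, Pi.pow_apply, Nat.add_sub_cancel]
    field_simp
    ring

theorem stmt_14 :
    iteratedDeriv 4 (fun z : ℂ => (4 * I * z ^ 3 - z ^ 2 + 17 * I * z) / (z + I) ^ 2) I = -21 := by
  have hI : I + I ≠ 0 := by simp [← two_mul]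
  have hne : ∀ᶠ z in nhds I, z + I ≠ 0 :=
    (continuous_id.add continuous_const).continuousAt.eventually_ne hI
  have hdecomp : (fun z : ℂ => (4 * I * z ^ 3 - z ^ 2 + 17 * I * z) / (z + I) ^ 2) =ᶠ[nhds I]
      fun z => 4 * I * z + 7 + 7 * I / (z + I) ^ 1 + 14 / (z + I) ^ 2 := by
    filter_upwards [hne] with z hz
    field_simp
    linear_combination (-8 * z ^ 2 - 4 * I * z - 14) * I_sq
  rw [hdecomp.iteratedDeriv_eq,
    iteratedDeriv_succ_eq_of_eventually_hasDerivAt (g := fun z =>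
      4 * I + -(7 * I) / (z + I) ^ 2 + -28 / (z + I) ^ 3) 3 ?_,
    iteratedDeriv_succ_eq_of_eventually_hasDerivAt (g := fun z =>
      14 * I / (z + I) ^ 3 + 84 / (z + I) ^ 4) 2 ?_,
    iteratedDeriv_succ_eq_of_eventually_hasDerivAt (g := fun z =>
      -(42 * I) / (z + I) ^ 4 + -336 / (z + I) ^ 5) 1 ?_,
    iteratedDeriv_succ_eq_of_eventually_hasDerivAt (g := fun z =>
      168 * I / (z + I) ^ 5 + 1680 / (z + I) ^ 6) 0 ?_, iteratedDeriv_zero]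
  · have h5 : (I + I) ^ 5 = 32 * I := by linear_combination 32 * I * (I ^ 2 - 1) * I_sq
    have h6 : (I + I) ^ 6 = -64 := by linear_combination 64 * (I ^ 4 - I ^ 2 + 1) * I_sq
    rw [h5, h6, mul_div_mul_right _ _ I_ne_zero]
    norm_num
  · filter_upwards [hne] with z hz
    refine ((hasDerivAt_const_div_add_pow _ I z 4 hz).add
      (hasDerivAt_const_div_add_pow _ I z 5 hz)).congr_deriv ?_
    push_cast
    ring
  · filter_upwards [hne] with z hz
    refine ((hasDerivAt_const_div_add_pow _ I z 3 hz).add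
      (hasDerivAt_const_div_add_pow _ I z 4 hz)).congr_deriv ?_
    push_cast
    ring
  · filter_upwards [hne] with z hz
    refine (((hasDerivAt_const_div_add_pow _ I z 2 hz).const_add _).add
      (hasDerivAt_const_div_add_pow _ I z 3 hz)).congr_deriv ?_
    push_cast
    ring
  · filter_upwards [hne] with z hz
    refine (((((hasDerivAt_id z).const_mul (4 * I)).add_const 7).add
      (hasDerivAt_const_div_add_pow _ I z 1 hz)).add
      (hasDerivAt_const_div_add_pow _ I z 2 hz)).congr_deriv ?_
    push_cast
    ring
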